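/- For every positive integer n and every nonnegative integer k, the number of involutions w ∈ S_n (permutations with w² = id) having exactly k fixed points equals the total number of standard Young tableaux whose shape is a partition λ of n with exactly k odd columns (i.e. the conjugate partition λ' has exactly k odd parts). -/

import Mathlib

/-- The weight of a semistandard Young tableau: `ssytWeight T i` is the number of cells of the
tableau whose entry equals `i`. -/
def ssytWeight {μ : YoungDiagram} (T : SemistandardYoungTableau μ) (i : ℕ) : ℕ :=
  (μ.cells.filter fun c => T c.1 c.2 = i).card

/-- `tabCard μ ν` is the number of semistandard Young tableaux of shape `μ` and weight `ν`,
where `ν : Fin n → ℕ`: the entry `j` (for `j < n`) occurs exactly `ν j` times, and no entry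
`≥ n` occurs. -/
noncomputable def tabCard (μ : YoungDiagram) {n : ℕ} (ν : Fin n → ℕ) : ℕ :=
  Set.ncard {T : SemistandardYoungTableau μ |
    ∀ j : ℕ, ssytWeight T j = if h : j < n then ν ⟨j, h⟩ else 0}

/-- The Schur polynomial `s_μ(x_0, …, x_{n-1})`, as the generating function of semistandard
Young tableaux of shape `μ` with entries in `{0, …, n-1}`. -/
noncomputable def schurPoly (n : ℕ) (μ : YoungDiagram) : MvPolynomial (Fin n) ℤ :=
  ∑ᶠ (T : SemistandardYoungTableau μ) (_ : ∀ c ∈ μ.cells, T c.1 c.2 < n),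
    ∏ i : Fin n, (MvPolynomial.X i : MvPolynomial (Fin n) ℤ) ^ ssytWeight T (i : ℕ)

/-- The number of odd rows (odd parts) of a Young diagram. -/
def oddRowsCount (lam : YoungDiagram) : ℕ :=
  lam.rowLens.countP fun r => r % 2 = 1

/-- The number of odd columns of a Young diagram. -/
def oddColsCount (lam : YoungDiagram) : ℕ :=
  oddRowsCount lam.transpose

/-- A Young diagram is a *threshold* partition if its Frobenius coordinates satisfy
`β i = α i + 1` for each `i` up to the Durfee rank; with 0-indexed diagrams this says that
`colLen i = rowLen i + 1` for each diagonal cell `(i, i)`. -/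
def YoungDiagram.IsThreshold (lam : YoungDiagram) : Prop :=
  ∀ i : ℕ, (i, i) ∈ lam → lam.colLen i = lam.rowLen i + 1

/-! ### Counting involutions by fixed points -/

namespace Equiv.Perm

/-- The number of fixed points of a permutation of `Fin n`. -/
def fixedCount {n : ℕ} (w : Equiv.Perm (Fin n)) : ℕ :=
  (Finset.univ.filter fun i => w i = i).card

/-- The involutions of `Fin n` with exactly `k` fixed points. -/
def involutionsWithFixed (n k : ℕ) : Finset (Equiv.Perm (Fin n)) :=
  Finset.univ.filter fun w => w * w = 1 ∧ w.fixedCount = k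

theorem mul_self_eq_one_iff {α : Type*} (w : Equiv.Perm α) : w * w = 1 ↔ ∀ x, w (w x) = x := by
  simp [Equiv.ext_iff]

theorem decomposeFin_symm_zero_mul_self {n : ℕ} (e : Equiv.Perm (Fin n)) :
    decomposeFin.symm (0, e) * decomposeFin.symm (0, e) = 1 ↔ e * e = 1 := by
  simp [mul_self_eq_one_iff, Fin.forall_fin_succ]

theorem fixedCount_decomposeFin_symm_zero {n : ℕ} (e : Equiv.Perm (Fin n)) :
    (decomposeFin.symm (0, e)).fixedCount = e.fixedCount + 1 := by
  simp [fixedCount, Fin.card_filter_univ_succ]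

theorem decomposeFin_symm_succ_apply {n : ℕ} (a : Fin n) (e : Equiv.Perm (Fin n)) (x : Fin n) :
    decomposeFin.symm (a.succ, e) x.succ = if e x = a then 0 else (e x).succ := by
  rw [decomposeFin_symm_apply_succ]
  split_ifs with h
  · rw [h, Equiv.swap_apply_right]
  · exact Equiv.swap_apply_of_ne_of_ne (Fin.succ_ne_zero _) (by simpa using h)

theorem decomposeFin_symm_succ_mul_self {n : ℕ} (a : Fin n) (e : Equiv.Perm (Fin n)) :
    decomposeFin.symm (a.succ, e) * decomposeFin.symm (a.succ, e) = 1 ↔ e * e = 1 ∧ e a = a := by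
  simp only [mul_self_eq_one_iff, Fin.forall_fin_succ, decomposeFin_symm_apply_zero,
    decomposeFin_symm_succ_apply]
  have key (h : e a = a) (x : Fin n) : e x = a ↔ x = a :=
    ⟨fun hx => e.injective (hx.trans h.symm), fun hx => hx ▸ h⟩
  constructor
  · rintro ⟨h0, h⟩
    have ha : e a = a := by
      by_contra hne
      simp [hne] at h0
    refine ⟨fun x => ?_, ha⟩
    by_cases hx : x = a
    · rw [hx, ha, ha]
    · have := h x
      rw [if_neg (by rwa [key ha]), decomposeFin_symm_succ_apply,
        if_neg (by rwa [key ha, key ha])] at this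
      exact Fin.succ_injective _ this
  · rintro ⟨h, ha⟩
    refine ⟨by simp [ha], fun x => ?_⟩
    by_cases hx : x = a
    · simp [hx, ha]
    · rw [if_neg (by rwa [key ha]), decomposeFin_symm_succ_apply,
        if_neg (by rwa [key ha, key ha]), h]

theorem fixedCount_decomposeFin_symm_succ {n : ℕ} (a : Fin n) (e : Equiv.Perm (Fin n))
    (ha : e a = a) : (decomposeFin.symm (a.succ, e)).fixedCount + 1 = e.fixedCount := by
  have h : (Finset.univ.filter fun i => decomposeFin.symm (a.succ, e) i.succ = i.succ) =
      (Finset.univ.filter fun i => e i = i).erase a := by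
    ext x
    simp only [decomposeFin_symm_succ_apply, Finset.mem_filter, Finset.mem_univ, true_and,
      Finset.mem_erase]
    split_ifs with hx
    · have : x = a := e.injective (hx.trans ha.symm)
      simp [this, (Fin.succ_ne_zero _).symm]
    · rw [Fin.succ_inj]
      exact ⟨fun h => ⟨fun hxa => hx (by rw [hxa, ha]), h⟩, fun h => h.2⟩
  rw [fixedCount, Fin.card_filter_univ_succ, decomposeFin_symm_apply_zero,
    if_neg (Fin.succ_ne_zero a)]
  simp only [h]
  exact Finset.card_erase_add_one (by simp [ha])

/-- Removing the point `0` from an involution of `Fin (n + 1)`: either it is fixed, or its partner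
becomes a fixed point. -/
theorem card_involutionsWithFixed_succ (n k : ℕ) :
    (involutionsWithFixed (n + 1) k).card =
      (if k = 0 then 0 else (involutionsWithFixed n (k - 1)).card) +
        (k + 1) * (involutionsWithFixed n (k + 1)).card := by
  have hsum : (involutionsWithFixed (n + 1) k).card =
      ∑ e : Equiv.Perm (Fin n), (if e * e = 1 ∧ e.fixedCount + 1 = k then 1 else 0) +
      ∑ a : Fin n, ∑ e : Equiv.Perm (Fin n),
        if (e * e = 1 ∧ e.fixedCount = k + 1) ∧ e a = a then 1 else 0 := by
    rw [involutionsWithFixed, Finset.card_filter, ← decomposeFin.symm.sum_comp,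
      Fintype.sum_prod_type, Fin.sum_univ_succ]
    congr 1
    · simp only [decomposeFin_symm_zero_mul_self, fixedCount_decomposeFin_symm_zero]
    · refine Finset.sum_congr rfl fun a _ => Finset.sum_congr rfl fun e _ => if_congr ?_ rfl rfl
      rw [decomposeFin_symm_succ_mul_self]
      constructor
      · rintro ⟨⟨h, ha⟩, hk⟩
        exact ⟨⟨h, by rw [← hk, fixedCount_decomposeFin_symm_succ a e ha]⟩, ha⟩
      · rintro ⟨⟨h, hk⟩, ha⟩
        have := fixedCount_decomposeFin_symm_succ a e ha
        exact ⟨⟨h, ha⟩, by omega⟩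
  rw [hsum]
  congr 1
  · split_ifs with hk
    · simp [hk]
    · rw [← Finset.card_filter, involutionsWithFixed]
      congr 1
      ext e
      simp only [Finset.mem_filter, Finset.mem_univ, true_and]
      exact and_congr_right fun _ => by omega
  · rw [Finset.sum_comm, mul_comm, involutionsWithFixed, ← smul_eq_mul, ← Finset.sum_const,
      Finset.sum_filter]
    refine Finset.sum_congr rfl fun e _ => ?_
    split_ifs with h
    · rw [← h.2, fixedCount, Finset.card_filter]
      simp [h]
    · simp [h]

theorem card_involutionsWithFixed_zero (k : ℕ) :
    (involutionsWithFixed 0 k).card = if k = 0 then 1 else 0 := by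
  have h (w : Equiv.Perm (Fin 0)) : w * w = 1 ∧ w.fixedCount = k ↔ k = 0 := by
    have hw : w = 1 := Subsingleton.elim _ _
    subst hw
    simp [fixedCount, eq_comm]
  simp only [involutionsWithFixed, h]
  split_ifs with hk <;> simp [hk]

/-- Double counting of pairs formed by an involution and one of its fixed points. -/
theorem mul_card_involutionsWithFixed (n k : ℕ) :
    (k + 1) * (involutionsWithFixed (n + 1) (k + 1)).card =
      (n + 1) * (involutionsWithFixed n k).card := by
  induction n generalizing k with
  | zero =>
    rw [card_involutionsWithFixed_succ]
    simp only [card_involutionsWithFixed_zero]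
    by_cases hk : k = 0 <;> simp [hk]
  | succ n ih =>
    have h1 := card_involutionsWithFixed_succ (n + 1) (k + 1)
    have h2 := ih (k + 1)
    have h3 := card_involutionsWithFixed_succ n k
    simp only [Nat.add_eq_zero_iff, one_ne_zero, and_false, if_false, Nat.add_sub_cancel] at h1
    rw [h2] at h1
    rw [h1]
    rcases k with _ | k
    · simp only [if_true, zero_add, one_mul] at h3 ⊢
      rw [h3]
      ring
    · have h4 := ih k
      simp only [Nat.add_eq_zero_iff, one_ne_zero, and_false, if_false, Nat.add_sub_cancel] at h3
      calc (k + 1 + 1) * ((involutionsWithFixed (n + 1) (k + 1)).card +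
              (n + 1) * (involutionsWithFixed n (k + 1 + 1)).card)
          = (k + 1) * (involutionsWithFixed (n + 1) (k + 1)).card +
              (involutionsWithFixed (n + 1) (k + 1)).card +
              (n + 1) * ((k + 1 + 1) * (involutionsWithFixed n (k + 1 + 1)).card) := by ring
        _ = (n + 1) * ((involutionsWithFixed n k).card +
              (k + 1 + 1) * (involutionsWithFixed n (k + 1 + 1)).card) +
              (involutionsWithFixed (n + 1) (k + 1)).card := by rw [h4]; ring
        _ = _ := by rw [← h3]; ring

/-- Removing a point from an involution, together with its partner if it is not fixed. -/
theorem card_involutionsWithFixed_succ' (n k : ℕ) :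
    (involutionsWithFixed (n + 1) k).card =
      (if k = 0 then 0 else (involutionsWithFixed n (k - 1)).card) +
        n * (involutionsWithFixed (n - 1) k).card := by
  rw [card_involutionsWithFixed_succ]
  congr 1
  rcases n with _ | n
  · simp [card_involutionsWithFixed_zero]
  · exact mul_card_involutionsWithFixed n k

end Equiv.Perm

/-! ### Covering relations between Young diagrams -/

namespace YoungDiagram

theorem colLen_le_card (lam : YoungDiagram) (j : ℕ) : lam.colLen j ≤ lam.card := by
  rw [colLen_eq_card]
  exact Finset.card_le_card (Finset.filter_subset _ _)

theorem rowLen_le_card (lam : YoungDiagram) (i : ℕ) : lam.rowLen i ≤ lam.card := by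
  rw [rowLen_eq_card]
  exact Finset.card_le_card (Finset.filter_subset _ _)

theorem finite_setOf_card_eq (n : ℕ) : {lam : YoungDiagram | lam.card = n}.Finite := by
  refine Set.Finite.of_finite_image (f := YoungDiagram.cells)
    ((Finset.range n ×ˢ Finset.range n).powerset.finite_toSet.subset ?_)
    fun a _ b _ h => YoungDiagram.ext h
  rintro _ ⟨lam, rfl, rfl⟩
  simp only [Finset.coe_powerset, Set.mem_preimage, Set.mem_powerset_iff, Finset.coe_subset]
  rintro ⟨i, j⟩ h
  rw [mem_cells] at h
  simp only [Finset.mem_product, Finset.mem_range]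
  exact ⟨(mem_iff_lt_colLen.1 h).trans_le (lam.colLen_le_card j),
    (mem_iff_lt_rowLen.1 h).trans_le (lam.rowLen_le_card i)⟩

/-- The Young diagrams with `n` cells. -/
noncomputable def ofCard (n : ℕ) : Finset YoungDiagram :=
  (finite_setOf_card_eq n).toFinset

@[simp]
theorem mem_ofCard {n : ℕ} {lam : YoungDiagram} : lam ∈ ofCard n ↔ lam.card = n := by
  simp [ofCard]

open Classical in
/-- The Young diagrams obtained from `lam` by adding one cell. -/
noncomputable def up (lam : YoungDiagram) : Finset YoungDiagram :=
  (ofCard (lam.card + 1)).filter (lam ≤ ·)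

open Classical in
/-- The Young diagrams obtained from `lam` by removing one cell. -/
noncomputable def down (lam : YoungDiagram) : Finset YoungDiagram :=
  (ofCard (lam.card - 1)).filter fun mu => mu ≤ lam ∧ mu.card + 1 = lam.card

theorem mem_up {lam mu : YoungDiagram} : mu ∈ lam.up ↔ lam ≤ mu ∧ mu.card = lam.card + 1 := by
  simp [up, and_comm]

theorem mem_down {lam mu : YoungDiagram} : mu ∈ lam.down ↔ mu ≤ lam ∧ mu.card + 1 = lam.card := by
  simp only [down, Finset.mem_filter, mem_ofCard]
  constructor
  · exact fun h => h.2
  · exact fun h => ⟨by omega, h⟩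

theorem mem_up_iff_mem_down {lam mu : YoungDiagram} : mu ∈ lam.up ↔ lam ∈ mu.down := by
  rw [mem_up, mem_down, eq_comm]

theorem mem_up_iff_exists_cells {lam mu : YoungDiagram} :
    mu ∈ lam.up ↔ ∃ c, c ∉ lam ∧ mu.cells = insert c lam.cells := by
  rw [mem_up]
  constructor
  · rintro ⟨hle, hcard⟩
    have h1 : (mu.cells \ lam.cells).card = 1 := by
      rw [Finset.card_sdiff_of_subset (cells_subset_iff.2 hle)]
      change mu.card - lam.card = 1
      omega
    obtain ⟨c, hc⟩ := Finset.card_eq_one.1 h1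
    refine ⟨c, ?_, ?_⟩
    · have : c ∈ mu.cells \ lam.cells := by simp [hc]
      exact (Finset.mem_sdiff.1 this).2
    · rw [← Finset.sdiff_union_of_subset (cells_subset_iff.2 hle), hc, Finset.insert_eq]
  · rintro ⟨c, hc, h⟩
    constructor
    · rw [← cells_subset_iff, h]
      exact Finset.subset_insert _ _
    · rw [YoungDiagram.card, h, Finset.card_insert_of_notMem hc]

theorem mem_of_cells_eq_insert {lam mu : YoungDiagram} {c x : ℕ × ℕ}
    (h : mu.cells = insert c lam.cells) : x ∈ mu ↔ x = c ∨ x ∈ lam := by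
  rw [← mem_cells, h, Finset.mem_insert, mem_cells]

/-- An added cell lies at the bottom of a column which is strictly shorter than its left
neighbour. -/
theorem addable_of_cells_eq_insert {lam mu : YoungDiagram} {i j : ℕ} (hc : (i, j) ∉ lam)
    (h : mu.cells = insert (i, j) lam.cells) :
    i = lam.colLen j ∧ (j = 0 ∨ lam.colLen j < lam.colLen (j - 1)) := by
  have hmem : (i, j) ∈ mu := (mem_of_cells_eq_insert h).2 (Or.inl rfl)
  have hi : lam.colLen j ≤ i := by rwa [mem_iff_lt_colLen, not_lt] at hc
  have hi' : i = lam.colLen j := by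
    rcases (mem_of_cells_eq_insert h).1 (mu.up_left_mem hi le_rfl hmem) with h1 | h1
    · simpa using (congrArg Prod.fst h1).symm
    · simp [mem_iff_lt_colLen] at h1
  refine ⟨hi', ?_⟩
  rcases j with _ | j
  · exact Or.inl rfl
  · right
    rcases (mem_of_cells_eq_insert h).1 (mu.up_left_mem le_rfl (Nat.le_succ j) hmem) with h1 | h1
    · simp at h1
    · rw [mem_iff_lt_colLen, hi'] at h1
      exact h1

/-- A removed cell lies at the bottom of a column which is strictly longer than its right
neighbour. -/
theorem removable_of_cells_eq_insert {lam mu : YoungDiagram} {i j : ℕ} (hc : (i, j) ∉ lam)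
    (h : mu.cells = insert (i, j) lam.cells) :
    mu.colLen j = i + 1 ∧ mu.colLen (j + 1) < mu.colLen j := by
  have hmem : (i, j) ∈ mu := (mem_of_cells_eq_insert h).2 (Or.inl rfl)
  have h1 : (i + 1, j) ∉ mu := fun h2 => by
    rcases (mem_of_cells_eq_insert h).1 h2 with h3 | h3
    · simp at h3
    · exact hc (lam.up_left_mem (Nat.le_succ i) le_rfl h3)
  have h2 : (i, j + 1) ∉ mu := fun h2 => by
    rcases (mem_of_cells_eq_insert h).1 h2 with h3 | h3
    · simp at h3
    · exact hc (lam.up_left_mem le_rfl (Nat.le_succ j) h3)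
  rw [mem_iff_lt_colLen] at hmem h1 h2
  omega

theorem colLen_of_cells_eq_insert {lam mu : YoungDiagram} {i j : ℕ}
    (h : mu.cells = insert (i, j) lam.cells) {x : ℕ} (hx : x ≠ j) :
    mu.colLen x = lam.colLen x := by
  have key (y : ℕ) : y < mu.colLen x ↔ y < lam.colLen x := by
    rw [← mem_iff_lt_colLen, ← mem_iff_lt_colLen, mem_of_cells_eq_insert h]
    simp [hx]
  have h1 := key (mu.colLen x)
  have h2 := key (lam.colLen x)
  omega

/-- The diagram obtained by adding a cell at the bottom of the column `j`. -/
def addCell (lam : YoungDiagram) (j : ℕ) (hj : j = 0 ∨ lam.colLen j < lam.colLen (j - 1)) :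
    YoungDiagram where
  cells := insert (lam.colLen j, j) lam.cells
  isLowerSet := by
    rintro ⟨a, b⟩ ⟨c, d⟩ hle hmem
    simp only [Prod.mk_le_mk] at hle
    simp only [Finset.coe_insert, Set.mem_insert_iff, Finset.mem_coe, mem_cells,
      Prod.mk.injEq] at hmem ⊢
    rcases hmem with ⟨rfl, rfl⟩ | hmem
    · rcases hle.2.lt_or_eq with hd | rfl
      · right
        rw [mem_iff_lt_colLen]
        have := lam.colLen_anti d (b - 1) (by omega)
        omega
      · rw [mem_iff_lt_colLen]
        omega
    · exact Or.inr (lam.up_left_mem hle.1 hle.2 hmem)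

/-- The diagram obtained by removing the bottom cell of the column `j`. -/
def removeCell (lam : YoungDiagram) (j : ℕ) (hj : lam.colLen (j + 1) < lam.colLen j) :
    YoungDiagram where
  cells := lam.cells.erase (lam.colLen j - 1, j)
  isLowerSet := by
    rintro ⟨a, b⟩ ⟨c, d⟩ hle hmem
    simp only [Prod.mk_le_mk] at hle
    simp only [Finset.coe_erase, Set.mem_sdiff, Finset.mem_coe, mem_cells, Set.mem_singleton_iff,
      Prod.mk.injEq] at hmem ⊢
    refine ⟨lam.up_left_mem hle.1 hle.2 hmem.1, ?_⟩
    rintro ⟨rfl, rfl⟩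
    obtain ⟨h1, h2⟩ := hmem
    rw [mem_iff_lt_colLen] at h1
    rcases hle.2.lt_or_eq with hd | rfl
    · have := lam.colLen_anti (d + 1) b hd
      omega
    · exact h2 ⟨by omega, rfl⟩

theorem colLen_corner_notMem (lam : YoungDiagram) (j : ℕ) : (lam.colLen j, j) ∉ lam := by
  simp [mem_iff_lt_colLen]

theorem cells_eq_insert_removeCell (lam : YoungDiagram) (j : ℕ)
    (hj : lam.colLen (j + 1) < lam.colLen j) :
    lam.cells = insert (lam.colLen j - 1, j) (lam.removeCell j hj).cells := by
  refine (Finset.insert_erase ?_).symm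
  rw [mem_cells, mem_iff_lt_colLen]
  omega

theorem corner_notMem_removeCell (lam : YoungDiagram) (j : ℕ)
    (hj : lam.colLen (j + 1) < lam.colLen j) :
    (lam.colLen j - 1, j) ∉ lam.removeCell j hj := by
  rw [← mem_cells]
  exact Finset.notMem_erase _ _

theorem colLen_eq_zero {lam : YoungDiagram} {j : ℕ} : lam.colLen j = 0 ↔ lam.rowLen 0 ≤ j := by
  rw [← not_lt, ← mem_iff_lt_rowLen, mem_iff_lt_colLen]
  omega

theorem sum_up {M : Type*} [AddCommMonoid M] (lam : YoungDiagram) (F : YoungDiagram → M)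
    (w : ℕ → M)
    (hw : ∀ mu i j, (i, j) ∉ lam → mu.cells = insert (i, j) lam.cells →
      F mu = w (lam.colLen j)) :
    ∑ mu ∈ lam.up, F mu = ∑ j ∈ (Finset.range (lam.rowLen 0 + 1)).filter
      (fun j => j = 0 ∨ lam.colLen j < lam.colLen (j - 1)), w (lam.colLen j) := by
  symm
  refine Finset.sum_bij (fun j hj => lam.addCell j (Finset.mem_filter.1 hj).2) ?_ ?_ ?_ ?_
  · exact fun j hj => mem_up_iff_exists_cells.2 ⟨_, lam.colLen_corner_notMem j, rfl⟩
  · intro a ha b hb hab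
    have : (lam.colLen a, a) ∈ lam.addCell b (Finset.mem_filter.1 hb).2 := by
      rw [← hab]
      exact Finset.mem_insert_self _ _
    rcases (mem_of_cells_eq_insert rfl).1 this with h | h
    · exact congrArg Prod.snd h
    · exact (lam.colLen_corner_notMem a h).elim
  · intro mu hmu
    obtain ⟨⟨i, j⟩, hc, h⟩ := mem_up_iff_exists_cells.1 hmu
    obtain ⟨rfl, hj⟩ := addable_of_cells_eq_insert hc h
    refine ⟨j, Finset.mem_filter.2 ⟨?_, hj⟩, YoungDiagram.ext h.symm⟩
    rw [Finset.mem_range]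
    by_contra hlt
    have : lam.colLen (j - 1) = 0 := colLen_eq_zero.2 (by omega)
    omega
  · exact fun j hj => (hw _ _ j (lam.colLen_corner_notMem j) rfl).symm

theorem sum_down {M : Type*} [AddCommMonoid M] (lam : YoungDiagram) (F : YoungDiagram → M)
    (w : ℕ → M)
    (hw : ∀ mu i j, (i, j) ∉ mu → lam.cells = insert (i, j) mu.cells →
      F mu = w (lam.colLen j)) :
    ∑ mu ∈ lam.down, F mu = ∑ j ∈ (Finset.range (lam.rowLen 0)).filter
      (fun j => lam.colLen (j + 1) < lam.colLen j), w (lam.colLen j) := by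
  symm
  refine Finset.sum_bij (fun j hj => lam.removeCell j (Finset.mem_filter.1 hj).2) ?_ ?_ ?_ ?_
  · exact fun j hj => mem_up_iff_mem_down.1 (mem_up_iff_exists_cells.2
      ⟨_, lam.corner_notMem_removeCell j _, lam.cells_eq_insert_removeCell j _⟩)
  · intro a ha b hb hab
    have h1 := lam.corner_notMem_removeCell a (Finset.mem_filter.1 ha).2
    rw [hab] at h1
    have h2 : (lam.colLen a - 1, a) ∈ lam := by
      have := (Finset.mem_filter.1 ha).2
      rw [mem_iff_lt_colLen]
      omega
    rcases (mem_of_cells_eq_insert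
      (lam.cells_eq_insert_removeCell b (Finset.mem_filter.1 hb).2)).1 h2 with h | h
    · exact congrArg Prod.snd h
    · exact (h1 h).elim
  · intro mu hmu
    obtain ⟨⟨i, j⟩, hc, h⟩ := mem_up_iff_exists_cells.1 (mem_up_iff_mem_down.2 hmu)
    obtain ⟨hi, hj⟩ := removable_of_cells_eq_insert hc h
    refine ⟨j, Finset.mem_filter.2 ⟨?_, hj⟩, YoungDiagram.ext ?_⟩
    · rw [Finset.mem_range]
      by_contra hlt
      have : lam.colLen j = 0 := colLen_eq_zero.2 (by omega)
      omega
    · change lam.cells.erase (lam.colLen j - 1, j) = mu.cells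
      rw [hi, h, Nat.add_sub_cancel, Finset.erase_insert hc]
  · exact fun j hj => (hw _ _ j (lam.corner_notMem_removeCell j _)
      (lam.cells_eq_insert_removeCell j _)).symm

theorem sum_range_descents {M : Type*} [AddCommMonoid M] (c : ℕ → ℕ) (hc : Antitone c)
    (w : ℕ → M) (N : ℕ) :
    (∑ j ∈ Finset.range N, if c (j + 1) < c j then w (c (j + 1)) else 0) + w (c 0) =
      (∑ j ∈ Finset.range N, if c (j + 1) < c j then w (c j) else 0) + w (c N) := by
  induction N with
  | zero => simp
  | succ N ih =>
    rw [Finset.sum_range_succ, Finset.sum_range_succ, add_right_comm, ih]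
    split_ifs with h
    · abel
    · rw [le_antisymm (not_lt.1 h) (hc (Nat.le_succ N))]
      abel

/-- A weighted form of the fact that a Young diagram has one more addable cell than removable
cells. -/
theorem sum_up_eq_sum_down_add {M : Type*} [AddCommMonoid M] (lam : YoungDiagram)
    (F : YoungDiagram → M) (w : ℕ → M)
    (hup : ∀ mu i j, (i, j) ∉ lam → mu.cells = insert (i, j) lam.cells →
      F mu = w (lam.colLen j))
    (hdown : ∀ mu i j, (i, j) ∉ mu → lam.cells = insert (i, j) mu.cells →
      F mu = w (lam.colLen j)) :
    ∑ mu ∈ lam.up, F mu = (∑ mu ∈ lam.down, F mu) + w 0 := by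
  rw [sum_up lam F w hup, sum_down lam F w hdown, Finset.sum_filter, Finset.sum_filter,
    Finset.sum_range_succ']
  simp only [Nat.add_eq_zero_iff, one_ne_zero, and_false, false_or, Nat.add_sub_cancel, true_or,
    if_true]
  rw [sum_range_descents lam.colLen (fun a b h => lam.colLen_anti a b h) w,
    colLen_eq_zero.2 le_rfl]

theorem card_up (lam : YoungDiagram) : lam.up.card = lam.down.card + 1 := by
  rw [Finset.card_eq_sum_ones, Finset.card_eq_sum_ones]
  exact sum_up_eq_sum_down_add lam (fun _ => 1) (fun _ => 1) (fun _ _ _ _ _ => rfl)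
    fun _ _ _ _ _ => rfl

theorem oddColsCount_eq_sum (lam : YoungDiagram) {N : ℕ} (hN : lam.rowLen 0 ≤ N) :
    oddColsCount lam = ∑ j ∈ Finset.range N, lam.colLen j % 2 := by
  have h1 : oddColsCount lam = ∑ j ∈ Finset.range (lam.rowLen 0), lam.colLen j % 2 := by
    have h2 (n : ℕ) : ((List.range n).map lam.colLen).countP (fun r => r % 2 = 1) =
        ∑ j ∈ Finset.range n, lam.colLen j % 2 := by
      induction n with
      | zero => simp
      | succ n ih =>
        rw [List.range_succ, List.map_append, List.countP_append, ih, Finset.sum_range_succ]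
        rcases Nat.mod_two_eq_zero_or_one (lam.colLen n) with h | h <;> simp [h]
    rw [oddColsCount, oddRowsCount, rowLens, colLen_transpose, ← h2]
    congr 2
    funext j
    exact lam.rowLen_transpose j
  rw [h1]
  refine Finset.sum_subset (Finset.range_subset_range.2 hN) fun j _ hj => ?_
  rw [Finset.mem_range, not_lt] at hj
  rw [colLen_eq_zero.2 hj, Nat.zero_mod]

theorem oddColsCount_of_cells_eq_insert {lam mu : YoungDiagram} {i j : ℕ} (hc : (i, j) ∉ lam)
    (h : mu.cells = insert (i, j) lam.cells) :
    oddColsCount mu + i % 2 = oddColsCount lam + (i + 1) % 2 := by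
  have hN1 : lam.rowLen 0 ≤ max (max (lam.rowLen 0) (mu.rowLen 0)) (j + 1) := by omega
  have hN2 : mu.rowLen 0 ≤ max (max (lam.rowLen 0) (mu.rowLen 0)) (j + 1) := by omega
  have hj : j ∈ Finset.range (max (max (lam.rowLen 0) (mu.rowLen 0)) (j + 1)) := by
    rw [Finset.mem_range]
    omega
  have h1 := (addable_of_cells_eq_insert hc h).1
  rw [oddColsCount_eq_sum lam hN1, oddColsCount_eq_sum mu hN2, ← Finset.add_sum_erase _ _ hj,
    ← Finset.add_sum_erase _ _ hj, (removable_of_cells_eq_insert hc h).1, ← h1,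
    Finset.sum_congr rfl fun x hx => by
      rw [colLen_of_cells_eq_insert h (Finset.ne_of_mem_erase hx)]]
  omega

/-- Adding a cell to `lam` yields `k` odd columns as often as removing a cell does, up to the
cell added in a new column. -/
theorem card_up_oddColsCount (lam : YoungDiagram) (k : ℕ) :
    (lam.up.filter fun mu => oddColsCount mu = k).card =
      (lam.down.filter fun mu => oddColsCount mu = k).card +
        if oddColsCount lam + 1 = k then 1 else 0 := by
  rw [Finset.card_filter, Finset.card_filter]
  refine sum_up_eq_sum_down_add lam _ (fun l => if oddColsCount lam + (l + 1) % 2 = k + l % 2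
    then 1 else 0) (fun mu i j hc h => ?_) fun mu i j hc h => ?_
  · have h1 := oddColsCount_of_cells_eq_insert hc h
    rw [← (addable_of_cells_eq_insert hc h).1]
    exact if_congr (by omega) rfl rfl
  · have h1 := oddColsCount_of_cells_eq_insert hc h
    rw [(removable_of_cells_eq_insert hc h).1]
    exact if_congr (by omega) rfl rfl

theorem card_sup_add_card_inf (lam mu : YoungDiagram) :
    (lam ⊔ mu).card + (lam ⊓ mu).card = lam.card + mu.card := by
  rw [YoungDiagram.card, YoungDiagram.card, cells_sup, cells_inf, Finset.card_union_add_card_inter]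

theorem eq_of_le_of_card_le {lam mu : YoungDiagram} (h : lam ≤ mu) (hcard : mu.card ≤ lam.card) :
    lam = mu :=
  YoungDiagram.ext (Finset.eq_of_subset_of_card_le (cells_subset_iff.2 h) hcard)

theorem card_lt_card_sup {lam nu : YoungDiagram} (hcard : nu.card = lam.card) (hne : nu ≠ lam) :
    lam.card < (lam ⊔ nu).card := by
  by_contra hlt
  have h : lam = lam ⊔ nu := eq_of_le_of_card_le le_sup_left (not_lt.1 hlt)
  exact hne (eq_of_le_of_card_le (h ▸ le_sup_right) hcard.ge)

theorem sup_eq_of_mem_up {lam mu nu : YoungDiagram} (h1 : mu ∈ lam.up) (h2 : nu ∈ mu.down)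
    (hne : nu ≠ lam) : lam ⊔ nu = mu ∧ lam ⊓ nu ∈ lam.down ∧ nu ∈ (lam ⊓ nu).up := by
  rw [mem_up] at h1
  rw [mem_down] at h2
  have hcard : nu.card = lam.card := by omega
  have h3 := card_sup_add_card_inf lam nu
  have h4 := card_lt_card_sup hcard hne
  have h5 : lam ⊔ nu = mu := eq_of_le_of_card_le (sup_le h1.1 h2.1) (by omega)
  rw [h5] at h3
  exact ⟨h5, mem_down.2 ⟨inf_le_left, by omega⟩, mem_up.2 ⟨inf_le_right, by omega⟩⟩

theorem inf_eq_of_mem_down {lam rho nu : YoungDiagram} (h1 : rho ∈ lam.down) (h2 : nu ∈ rho.up)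
    (hne : nu ≠ lam) : lam ⊓ nu = rho ∧ lam ⊔ nu ∈ lam.up ∧ nu ∈ (lam ⊔ nu).down := by
  rw [mem_down] at h1
  rw [mem_up] at h2
  have hcard : nu.card = lam.card := by omega
  have h3 := card_sup_add_card_inf lam nu
  have h4 := card_lt_card_sup hcard hne
  have h5 : rho = lam ⊓ nu := eq_of_le_of_card_le (le_inf h1.1 h2.1) (by omega)
  rw [← h5] at h3
  exact ⟨h5.symm, mem_up.2 ⟨le_sup_left, by omega⟩, mem_down.2 ⟨le_sup_right, by omega⟩⟩

open Classical in
/-- The commutation relation between adding and removing a cell in Young's lattice. -/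
theorem sum_up_sum_down {M : Type*} [AddCommMonoid M] (lam : YoungDiagram)
    (F : YoungDiagram → M) :
    ∑ mu ∈ lam.up, ∑ nu ∈ mu.down, F nu = (∑ rho ∈ lam.down, ∑ nu ∈ rho.up, F nu) + F lam := by
  have h1 : ∑ mu ∈ lam.up, ∑ nu ∈ mu.down, F nu =
      lam.up.card • F lam + ∑ mu ∈ lam.up, ∑ nu ∈ mu.down.erase lam, F nu := by
    rw [← Finset.sum_const, ← Finset.sum_add_distrib]
    exact Finset.sum_congr rfl fun mu hmu =>
      (Finset.add_sum_erase _ _ (mem_up_iff_mem_down.1 hmu)).symm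
  have h2 : ∑ rho ∈ lam.down, ∑ nu ∈ rho.up, F nu =
      lam.down.card • F lam + ∑ rho ∈ lam.down, ∑ nu ∈ rho.up.erase lam, F nu := by
    rw [← Finset.sum_const, ← Finset.sum_add_distrib]
    exact Finset.sum_congr rfl fun mu hmu =>
      (Finset.add_sum_erase _ _ (mem_up_iff_mem_down.2 hmu)).symm
  have h3 : ∑ mu ∈ lam.up, ∑ nu ∈ mu.down.erase lam, F nu =
      ∑ rho ∈ lam.down, ∑ nu ∈ rho.up.erase lam, F nu := by
    rw [Finset.sum_sigma', Finset.sum_sigma']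
    refine Finset.sum_bij' (fun x _ => ⟨lam ⊓ x.2, x.2⟩) (fun x _ => ⟨lam ⊔ x.2, x.2⟩)
      ?_ ?_ ?_ ?_ fun _ _ => rfl
    all_goals
      rintro ⟨a, b⟩ h
      simp only [Finset.mem_sigma, Finset.mem_erase] at h ⊢
    · have := sup_eq_of_mem_up h.1 h.2.2 h.2.1
      exact ⟨this.2.1, h.2.1, this.2.2⟩
    · have := inf_eq_of_mem_down h.1 h.2.2 h.2.1
      exact ⟨this.2.1, h.2.1, this.2.2⟩
    · rw [(sup_eq_of_mem_up h.1 h.2.2 h.2.1).1]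
    · rw [(inf_eq_of_mem_down h.1 h.2.2 h.2.1).1]
  rw [h1, h2, h3, card_up, succ_nsmul]
  abel

end YoungDiagram

/-! ### Standard Young tableaux -/

namespace SemistandardYoungTableau

/-- The standard Young tableaux of shape `mu` with entries `0, …, n - 1`. -/
def standard (n : ℕ) (mu : YoungDiagram) : Set (SemistandardYoungTableau mu) :=
  {T | ∀ j : ℕ, ssytWeight T j = if j < n then 1 else 0}

theorem tabCard_one_eq_ncard_standard (n : ℕ) (mu : YoungDiagram) :
    tabCard mu (fun _ : Fin n => 1) = (standard n mu).ncard := by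
  simp [tabCard, standard]

variable {n : ℕ} {mu nu : YoungDiagram}

theorem entry_lt_of_mem_standard {T : SemistandardYoungTableau mu} (hT : T ∈ standard n mu)
    {i j : ℕ} (hc : (i, j) ∈ mu) : T i j < n := by
  by_contra hlt
  have h := hT (T i j)
  rw [if_neg hlt, ssytWeight, Finset.card_eq_zero] at h
  have : (i, j) ∈ mu.cells.filter fun c => T c.1 c.2 = T i j :=
    Finset.mem_filter.2 ⟨hc, rfl⟩
  simp [h] at this

theorem finite_standard (n : ℕ) (mu : YoungDiagram) : (standard n mu).Finite := by
  refine Set.Finite.of_finite_image (f := fun T (c : mu.cells) => T c.1.1 c.1.2)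
    ((Set.Finite.pi' fun _ => Set.finite_Iio n).subset ?_) ?_
  · rintro _ ⟨T, hT, rfl⟩ c
    exact entry_lt_of_mem_standard hT c.2
  · intro T _ T' _ h
    ext i j
    by_cases hc : (i, j) ∈ mu
    · exact congrFun h ⟨(i, j), hc⟩
    · rw [T.zeros hc, T'.zeros hc]

/-- The restriction of a tableau to a smaller diagram. -/
def restrict (h : nu ≤ mu) (T : SemistandardYoungTableau mu) : SemistandardYoungTableau nu where
  entry i j := if (i, j) ∈ nu then T i j else 0
  row_weak' hj hc := by
    rw [if_pos hc, if_pos (nu.up_left_mem le_rfl hj.le hc)]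
    exact T.row_weak hj (h hc)
  col_strict' hi hc := by
    rw [if_pos hc, if_pos (nu.up_left_mem hi.le le_rfl hc)]
    exact T.col_strict hi (h hc)
  zeros' hc := if_neg hc

theorem restrict_apply (h : nu ≤ mu) (T : SemistandardYoungTableau mu) (i j : ℕ) :
    restrict h T i j = if (i, j) ∈ nu then T i j else 0 :=
  rfl

/-- The extension of a tableau with entries less than `n` by one cell with entry `n`. -/
def extend (n : ℕ) (h : nu ≤ mu) (hcard : mu.card = nu.card + 1) (T : SemistandardYoungTableau nu)
    (hT : ∀ i j, (i, j) ∈ nu → T i j < n) : SemistandardYoungTableau mu where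
  entry i j := if (i, j) ∈ nu then T i j else if (i, j) ∈ mu then n else 0
  row_weak' {i j1 j2} hj hc := by
    by_cases h2 : (i, j2) ∈ nu
    · rw [if_pos h2, if_pos (nu.up_left_mem le_rfl hj.le h2)]
      exact T.row_weak hj h2
    · rw [if_neg h2, if_pos hc]
      split_ifs with h1
      · exact (hT _ _ h1).le
      · exact le_rfl
      · exact Nat.zero_le n
  col_strict' {i1 i2 j} hi hc := by
    by_cases h2 : (i2, j) ∈ nu
    · rw [if_pos h2, if_pos (nu.up_left_mem hi.le le_rfl h2)]
      exact T.col_strict hi h2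
    · have h1 : (i1, j) ∈ nu := by
        obtain ⟨c, -, hins⟩ :=
          YoungDiagram.mem_up_iff_exists_cells.1 (YoungDiagram.mem_up.2 ⟨h, hcard⟩)
        have h3 := ((YoungDiagram.mem_of_cells_eq_insert hins).1 hc).resolve_right h2
        refine ((YoungDiagram.mem_of_cells_eq_insert hins).1
          (mu.up_left_mem hi.le le_rfl hc)).resolve_left fun h4 => ?_
        have := congrArg Prod.fst (h3.trans h4.symm)
        exact hi.ne' this
      rw [if_neg h2, if_pos hc, if_pos h1]
      exact hT _ _ h1
  zeros' hc := by rw [if_neg fun h' => hc (h h'), if_neg hc]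

theorem extend_apply (h : nu ≤ mu) (hcard : mu.card = nu.card + 1)
    (T : SemistandardYoungTableau nu) (hT : ∀ i j, (i, j) ∈ nu → T i j < n) (i j : ℕ) :
    extend n h hcard T hT i j = if (i, j) ∈ nu then T i j else if (i, j) ∈ mu then n else 0 :=
  rfl

theorem extend_mem_standard (h : nu ≤ mu) (hcard : mu.card = nu.card + 1)
    {T : SemistandardYoungTableau nu} (hT : T ∈ standard n nu) :
    extend n h hcard T (fun _ _ hc => entry_lt_of_mem_standard hT hc) ∈ standard (n + 1) mu := by
  intro j
  obtain ⟨⟨a, b⟩, hc, hins⟩ :=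
    YoungDiagram.mem_up_iff_exists_cells.1 (YoungDiagram.mem_up.2 ⟨h, hcard⟩)
  have hmem : (a, b) ∈ mu := (YoungDiagram.mem_of_cells_eq_insert hins).2 (Or.inl rfl)
  have hw := hT j
  rw [ssytWeight] at hw ⊢
  have hfil : (nu.cells.filter fun c =>
      extend n h hcard T (fun _ _ hc => entry_lt_of_mem_standard hT hc) c.1 c.2 = j) =
      nu.cells.filter fun c => T c.1 c.2 = j :=
    Finset.filter_congr fun c hc' => by rw [extend_apply, if_pos ((nu.mem_cells c).1 hc')]
  rw [hins, Finset.filter_insert, hfil, extend_apply, if_neg hc, if_pos hmem]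
  by_cases hj : n = j
  · rw [if_pos hj, Finset.card_insert_of_notMem fun h' => hc (Finset.mem_filter.1 h').1, hw,
      if_neg (by omega), if_pos (by omega)]
  · rw [if_neg hj, hw]
    exact if_congr (by omega) rfl rfl

/-- The cells with entry less than `n`. -/
def below (T : SemistandardYoungTableau mu) (n : ℕ) : YoungDiagram where
  cells := mu.cells.filter fun c => T c.1 c.2 < n
  isLowerSet := by
    rintro ⟨a, b⟩ ⟨c, d⟩ hle hmem
    simp only [Prod.mk_le_mk] at hle
    simp only [Finset.coe_filter, Set.mem_ofPred_eq, YoungDiagram.mem_cells] at hmem ⊢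
    refine ⟨mu.up_left_mem hle.1 hle.2 hmem.1, lt_of_le_of_lt ?_ hmem.2⟩
    exact (T.col_weak hle.1 (mu.up_left_mem le_rfl hle.2 hmem.1)).trans
      (T.row_weak_of_le hle.2 hmem.1)

theorem mem_below {T : SemistandardYoungTableau mu} {i j : ℕ} :
    (i, j) ∈ T.below n ↔ (i, j) ∈ mu ∧ T i j < n := by
  rw [← YoungDiagram.mem_cells, below, Finset.mem_filter, YoungDiagram.mem_cells]

theorem below_mem_down {T : SemistandardYoungTableau mu} (hT : T ∈ standard (n + 1) mu) :
    T.below n ∈ mu.down := by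
  refine YoungDiagram.mem_down.2 ⟨Finset.filter_subset _ _, ?_⟩
  have h1 := Finset.card_filter_add_card_filter_not (s := mu.cells) fun c => T c.1 c.2 < n
  have h2 : (mu.cells.filter fun c => ¬ T c.1 c.2 < n) = mu.cells.filter fun c => T c.1 c.2 = n :=
    Finset.filter_congr fun c hc => by
      have := entry_lt_of_mem_standard hT hc
      omega
  have h3 := hT n
  rw [if_pos (Nat.lt_succ_self n), ssytWeight, ← h2] at h3
  rw [h3] at h1
  exact h1

theorem restrict_mem_standard (h : nu ≤ mu) {T : SemistandardYoungTableau mu}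
    (hT : T ∈ standard (n + 1) mu) (hnu : T.below n = nu) : restrict h T ∈ standard n nu := by
  intro j
  subst hnu
  rw [ssytWeight]
  have h1 : ((T.below n).cells.filter fun c => restrict h T c.1 c.2 = j) =
      if j < n then mu.cells.filter fun c => T c.1 c.2 = j else ∅ := by
    ext ⟨a, b⟩
    simp only [Finset.mem_filter, restrict_apply, YoungDiagram.mem_cells, mem_below]
    split_ifs with h2 h3 h3
    · simp only [Finset.mem_filter, YoungDiagram.mem_cells]
      tauto
    · simp only [Finset.notMem_empty, iff_false]
      omega
    · simp only [Finset.mem_filter, YoungDiagram.mem_cells]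
      constructor
      · exact fun h' => (h2 h'.1).elim
      · rintro ⟨h4, rfl⟩
        exact (h2 ⟨h4, h3⟩).elim
    · simp only [Finset.notMem_empty, iff_false]
      tauto
  rw [h1]
  split_ifs with h2
  · exact (hT j).trans (if_pos (by omega))
  · rfl

/-- Removing the cell with the largest entry from a standard tableau. -/
theorem ncard_standard_succ (n : ℕ) (mu : YoungDiagram) (hmu : mu.card = n + 1) :
    (standard (n + 1) mu).ncard = ∑ nu ∈ mu.down, (standard n nu).ncard := by
  classical
  rw [Set.ncard_eq_toFinset_card _ (finite_standard _ _),
    Finset.card_eq_sum_card_fiberwise (f := fun T => T.below n) (t := mu.down) fun T hT =>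
      below_mem_down (by simpa using hT)]
  refine Finset.sum_congr rfl fun nu hnu => ?_
  rw [YoungDiagram.mem_down] at hnu
  rw [Set.ncard_eq_toFinset_card _ (finite_standard _ _)]
  refine Finset.card_bij (fun T _ => restrict hnu.1 T) ?_ ?_ ?_
  · intro T hT
    simp only [Finset.mem_filter, Set.Finite.mem_toFinset] at hT ⊢
    exact restrict_mem_standard hnu.1 hT.1 hT.2
  · intro T hT T' hT' heq
    simp only [Finset.mem_filter, Set.Finite.mem_toFinset] at hT hT'
    ext i j
    by_cases h1 : (i, j) ∈ mu
    · have h2 := entry_lt_of_mem_standard hT.1 h1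
      have h3 := entry_lt_of_mem_standard hT'.1 h1
      by_cases h4 : (i, j) ∈ nu
      · have := congrArg (fun S : SemistandardYoungTableau nu => S i j) heq
        simpa [restrict_apply, h4] using this
      · have h5 := h4
        rw [← hT.2, mem_below] at h4
        rw [← hT'.2, mem_below] at h5
        have h6 : ¬ T i j < n := fun h => h4 ⟨h1, h⟩
        have h7 : ¬ T' i j < n := fun h => h5 ⟨h1, h⟩
        omega
    · rw [T.zeros h1, T'.zeros h1]
  · intro T hT
    rw [Set.Finite.mem_toFinset] at hT
    refine ⟨extend n hnu.1 hnu.2.symm T fun _ _ hc => entry_lt_of_mem_standard hT hc, ?_, ?_⟩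
    · simp only [Finset.mem_filter, Set.Finite.mem_toFinset]
      refine ⟨extend_mem_standard _ _ hT, SetLike.ext fun ⟨i, j⟩ => ?_⟩
      rw [mem_below, extend_apply]
      by_cases h1 : (i, j) ∈ nu
      · simpa [h1, hnu.1 h1] using entry_lt_of_mem_standard hT h1
      · simp only [h1, if_false, iff_false, not_and]
        intro h2
        simp [h2]
    · ext i j
      rw [restrict_apply, extend_apply]
      split_ifs with h1
      · rfl
      · exact (T.zeros h1).symm

theorem ncard_standard_zero_bot : (standard 0 ⊥).ncard = 1 := by
  rw [Set.ncard_eq_one]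
  refine ⟨default, Set.eq_singleton_iff_unique_mem.2 ⟨fun j => ?_, fun T _ => ?_⟩⟩
  · simp [ssytWeight]
  · ext i j
    rw [T.zeros (YoungDiagram.notMem_bot _), zeros _ (YoungDiagram.notMem_bot _)]

/-- The number of pairs formed by a standard tableau and an extra cell. -/
theorem sum_up_ncard_standard (n : ℕ) (lam : YoungDiagram) (hlam : lam.card = n) :
    ∑ mu ∈ lam.up, (standard (n + 1) mu).ncard = (n + 1) * (standard n lam).ncard := by
  induction n generalizing lam with
  | zero =>
    have hdown : lam.down = ∅ := Finset.eq_empty_of_forall_notMem fun mu hmu => by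
      have := (YoungDiagram.mem_down.1 hmu).2
      omega
    rw [Finset.sum_congr rfl fun mu hmu => ncard_standard_succ 0 mu
      ((YoungDiagram.mem_up.1 hmu).2.trans (by rw [hlam])), YoungDiagram.sum_up_sum_down, hdown]
    simp
  | succ n ih =>
    rw [Finset.sum_congr rfl fun mu hmu => ncard_standard_succ (n + 1) mu
        ((YoungDiagram.mem_up.1 hmu).2.trans (by rw [hlam])), YoungDiagram.sum_up_sum_down,
      Finset.sum_congr rfl fun rho hrho => ih rho (by
        have := (YoungDiagram.mem_down.1 hrho).2
        omega), ← Finset.mul_sum, ← ncard_standard_succ n lam hlam]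
    ring

/-- The number of standard tableaux with `n` cells whose shape has exactly `k` odd columns. -/
noncomputable def standardOddCols (n k : ℕ) : ℕ :=
  ∑ lam ∈ (YoungDiagram.ofCard n).filter (fun lam => oddColsCount lam = k), (standard n lam).ncard

theorem standardOddCols_succ (n k : ℕ) :
    standardOddCols (n + 1) k =
      (if k = 0 then 0 else standardOddCols n (k - 1)) + n * standardOddCols (n - 1) k := by
  have h1 : standardOddCols (n + 1) k = ∑ nu ∈ YoungDiagram.ofCard n,
      (nu.up.filter fun mu => oddColsCount mu = k).card * (standard n nu).ncard := by
    rw [standardOddCols, Finset.sum_congr rfl fun mu hmu => ncard_standard_succ n mu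
      (YoungDiagram.mem_ofCard.1 (Finset.mem_filter.1 hmu).1),
      Finset.sum_comm' (t' := YoungDiagram.ofCard n)
        (s' := fun nu => nu.up.filter fun mu => oddColsCount mu = k)]
    · simp
    · intro mu nu
      simp only [Finset.mem_filter, YoungDiagram.mem_ofCard, YoungDiagram.mem_up,
        YoungDiagram.mem_down]
      constructor
      · rintro ⟨⟨h1, h2⟩, h3, h4⟩
        exact ⟨⟨⟨h3, by omega⟩, h2⟩, by omega⟩
      · rintro ⟨⟨⟨h3, h4⟩, h2⟩, h1⟩
        exact ⟨⟨by omega, h2⟩, h3, by omega⟩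
  have h2 : ∑ nu ∈ YoungDiagram.ofCard n,
      (nu.down.filter fun mu => oddColsCount mu = k).card * (standard n nu).ncard =
      n * standardOddCols (n - 1) k := by
    rcases n with _ | n
    · rw [zero_mul]
      refine Finset.sum_eq_zero fun nu hnu => ?_
      rw [YoungDiagram.mem_ofCard] at hnu
      rw [Finset.card_eq_zero.2, zero_mul]
      refine Finset.filter_eq_empty_iff.2 fun mu hmu => ?_
      have := (YoungDiagram.mem_down.1 hmu).2
      omega
    · rw [Nat.add_sub_cancel, standardOddCols, Finset.mul_sum,
        Finset.sum_congr rfl fun rho hrho => (sum_up_ncard_standard n rho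
          (YoungDiagram.mem_ofCard.1 (Finset.mem_filter.1 hrho).1)).symm,
        Finset.sum_comm' (t' := YoungDiagram.ofCard (n + 1))
          (s' := fun nu => nu.down.filter fun mu => oddColsCount mu = k)]
      · simp
      · intro rho nu
        simp only [Finset.mem_filter, YoungDiagram.mem_ofCard, YoungDiagram.mem_up,
          YoungDiagram.mem_down]
        constructor
        · rintro ⟨⟨h1, h2⟩, h3, h4⟩
          exact ⟨⟨⟨h3, by omega⟩, h2⟩, by omega⟩
        · rintro ⟨⟨⟨h3, h4⟩, h2⟩, h1⟩
          exact ⟨⟨by omega, h2⟩, h3, by omega⟩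
  have h3 : ∑ nu ∈ YoungDiagram.ofCard n,
      (if oddColsCount nu + 1 = k then 1 else 0) * (standard n nu).ncard =
      if k = 0 then 0 else standardOddCols n (k - 1) := by
    split_ifs with hk
    · simp [hk]
    · rw [standardOddCols, Finset.sum_filter]
      refine Finset.sum_congr rfl fun nu _ => ?_
      rw [ite_mul, one_mul, zero_mul]
      exact if_congr (by omega) rfl rfl
  rw [h1, ← h2, ← h3, ← Finset.sum_add_distrib]
  refine Finset.sum_congr rfl fun nu _ => ?_
  rw [YoungDiagram.card_up_oddColsCount]
  ring

theorem standardOddCols_zero (k : ℕ) : standardOddCols 0 k = if k = 0 then 1 else 0 := by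
  have h1 : YoungDiagram.ofCard 0 = {⊥} := by
    ext lam
    rw [YoungDiagram.mem_ofCard, Finset.mem_singleton]
    exact Finset.card_eq_zero.trans ⟨fun h => YoungDiagram.ext h, fun h => by rw [h]; rfl⟩
  have h2 : oddColsCount ⊥ = 0 := by
    rw [YoungDiagram.oddColsCount_eq_sum ⊥ (N := 0)]
    · rfl
    · exact ((⊥ : YoungDiagram).rowLen_le_card 0).trans_eq rfl
  rw [standardOddCols, h1, Finset.sum_filter, Finset.sum_singleton, h2, ncard_standard_zero_bot]
  exact if_congr eq_comm rfl rfl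

theorem card_involutionsWithFixed_eq_standardOddCols (n k : ℕ) :
    (Equiv.Perm.involutionsWithFixed n k).card = standardOddCols n k := by
  induction n using Nat.strong_induction_on generalizing k with
  | _ n ih =>
    rcases n with _ | n
    · rw [Equiv.Perm.card_involutionsWithFixed_zero, standardOddCols_zero]
    · rw [Equiv.Perm.card_involutionsWithFixed_succ', standardOddCols_succ,
        ih n (Nat.lt_succ_self n), ih (n - 1) (by omega)]

end SemistandardYoungTableau

/-- **Involutions with `k` fixed points vs standard tableaux with `k` odd columns.**
The number of involutions of `{1,…,n}` with exactly `k` fixed points equals the number of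
standard Young tableaux whose shape is a partition of `n` with exactly `k` odd columns. -/
theorem involutions_fixed_points_card (n k : ℕ) (hn : 0 < n) :
    Set.ncard {w : Equiv.Perm (Fin n) |
        w * w = 1 ∧ (Finset.univ.filter fun i => w i = i).card = k} =
      ∑ᶠ (lam : YoungDiagram) (_ : lam.card = n ∧ oddColsCount lam = k),
        tabCard lam (fun _ : Fin n => 1) := by
  have h1 : {w : Equiv.Perm (Fin n) |
      w * w = 1 ∧ (Finset.univ.filter fun i => w i = i).card = k} =
      (Equiv.Perm.involutionsWithFixed n k : Set (Equiv.Perm (Fin n))) := by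
    ext w
    rw [Finset.mem_coe, Equiv.Perm.involutionsWithFixed, Finset.mem_filter]
    exact (and_iff_right (Finset.mem_univ w)).symm
  rw [h1, Set.ncard_coe_finset,
    SemistandardYoungTableau.card_involutionsWithFixed_eq_standardOddCols,
    SemistandardYoungTableau.standardOddCols, finsum_cond_eq_sum_of_cond_iff]
  · exact Finset.sum_congr rfl fun lam _ =>
      (SemistandardYoungTableau.tabCard_one_eq_ncard_standard n lam).symm
  · intro lam _
    simp
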